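/- arXiv:0810.5290 — 4 statements merged into one kernel-verified Lean document; each statement's English description precedes it below -/
import Mathlib

section
/- Let n be a positive integer and let S be a set of index pairs S ⊆ {(i,j) | i < j, i,j = 1,…,n}. Given weights p_i ∈ ℝ for i = 1,…,n and p_{ij} ∈ ℝ for (i,j) ∈ S, the following are equivalent: (1) there exists a probability measure space (Ω, σ(Ω), P) and measurable events E_1,…,E_n ∈ σ(Ω) such that P(E_i) = p_i for all i and P(E_i ∩ E_j) = p_{ij} for all (i,j) ∈ S; (2) the correlation vector p⃗ = (p_1,…,p_n, …, p_{ij}, …) ∈ ℝ^{n+|S|} lies in the convex hull of the finite set of vertices {u^ε | ε ∈ {0,1}^n}, where u^ε has coordinates u^ε_i = ε_i for i = 1,…,n and u^ε_{ij} = ε_i ε_j for (i,j) ∈ S. -/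
open MeasureTheory

/-- A set of weights `p i` (for concepts) and `pC q` (for the measured
conjunctions, `q ∈ S`) is classical — i.e. admits a probability-measure representation —
if and only if its correlation vector lies in the convex hull of the vertices `u^ε`,
`ε ∈ {0,1}^n`. -/
theorem classical_weights_iff_mem_correlation_polytope
    (n : ℕ) (hn : 0 < n) (S : Finset (Fin n × Fin n)) (hS : ∀ q ∈ S, q.1 < q.2)
    (p : Fin n → ℝ) (pC : Fin n × Fin n → ℝ) :
    (∃ (Ω : Type) (_ : MeasurableSpace Ω) (P : Measure Ω),
        IsProbabilityMeasure P ∧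
        ∃ E : Fin n → Set Ω, (∀ i, MeasurableSet (E i)) ∧
          (∀ i, (P (E i)).toReal = p i) ∧
          (∀ q ∈ S, (P (E q.1 ∩ E q.2)).toReal = pC q)) ↔
    (Sum.elim p (fun q : {q // q ∈ S} => pC q.1) : (Fin n ⊕ {q // q ∈ S}) → ℝ) ∈
      convexHull ℝ (Set.range (fun ε : Fin n → Bool =>
        (Sum.elim (fun i => if ε i then (1 : ℝ) else 0)
          (fun q : {q // q ∈ S} => if ε q.1.1 && ε q.1.2 then (1 : ℝ) else 0) :
            (Fin n ⊕ {q // q ∈ S}) → ℝ))) := by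
  constructor
  · rintro ⟨Ω, _, P, hP, E, hE, hp, hpC⟩
    classical
    let g : Ω → (Fin n ⊕ {q // q ∈ S}) → ℝ := fun ω =>
      Sum.elim (fun i => (E i).indicator (fun _ => (1 : ℝ)) ω)
        (fun q => (E q.1.1 ∩ E q.1.2).indicator (fun _ => (1 : ℝ)) ω)
    have hg : ∀ k, Integrable (fun ω => g ω k) P := by
      rintro (i | q)
      · exact (integrable_const (1 : ℝ)).indicator (hE i)
      · exact (integrable_const (1 : ℝ)).indicator ((hE q.1.1).inter (hE q.1.2))
    have hcl : IsClosed (convexHull ℝ (Set.range (fun ε : Fin n → Bool =>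
        (Sum.elim (fun i => if ε i then (1 : ℝ) else 0)
          (fun q : {q // q ∈ S} => if ε q.1.1 && ε q.1.2 then (1 : ℝ) else 0) :
            (Fin n ⊕ {q // q ∈ S}) → ℝ)))) :=
      (Set.finite_range _).isClosed_convexHull ℝ
    have key := (convex_convexHull ℝ _).integral_mem (μ := P) (f := g) hcl
      (Filter.Eventually.of_forall fun ω => subset_convexHull ℝ _
        ⟨fun i => decide (ω ∈ E i), by
          funext k
          rcases k with i | q
          · simp [g, Set.indicator_apply]
          · simp [g, Set.indicator_apply]⟩)
      (Integrable.of_eval hg)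
    convert key using 1
    funext k
    rw [eval_integral hg]
    rcases k with i | q
    · have : ∫ ω, (E i).indicator (fun _ => (1 : ℝ)) ω ∂P = P.real (E i) := by
        rw [integral_indicator_const _ (hE i)]; simp
      exact (this.trans (hp i)).symm
    · have : ∫ ω, (E q.1.1 ∩ E q.1.2).indicator (fun _ => (1 : ℝ)) ω ∂P
          = P.real (E q.1.1 ∩ E q.1.2) := by
        rw [integral_indicator_const _ ((hE q.1.1).inter (hE q.1.2))]; simp
      exact (this.trans (hpC q.1 q.2)).symm
  · intro h
    classical
    rw [convexHull_range_eq_exists_affineCombination] at h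
    obtain ⟨s, w, hw0, hw1, h⟩ := h
    rw [s.affineCombination_eq_linear_combination _ _ hw1] at h
    let P : @Measure (Fin n → Bool) ⊤ :=
      ∑ ε ∈ s, ENNReal.ofReal (w ε) • @Measure.dirac _ ⊤ ε
    have hP : ∀ A : Set (Fin n → Bool),
        P A = ∑ ε ∈ s, ENNReal.ofReal (w ε) * (if ε ∈ A then 1 else 0) := by
      intro A
      simp only [P, Measure.finsetSum_apply, Measure.smul_apply, smul_eq_mul]
      refine Finset.sum_congr rfl fun ε _ => ?_
      rw [@Measure.dirac_apply' _ ⊤ _ _ trivial]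
      simp [Set.indicator_apply]
    have hR : ∀ A : Set (Fin n → Bool),
        (P A).toReal = ∑ ε ∈ s, w ε * (if ε ∈ A then 1 else 0) := by
      intro A
      rw [hP, ENNReal.toReal_sum]
      · refine Finset.sum_congr rfl fun ε hε => ?_
        split_ifs <;> simp [hw0 ε hε]
      · intro ε _
        split_ifs <;> simp
    refine ⟨Fin n → Bool, ⊤, P, ⟨?_⟩, fun i => {ε | ε i = true}, fun _ => trivial, ?_, ?_⟩
    · rw [hP]
      simp only [Set.mem_univ, if_true, mul_one]
      rw [← ENNReal.ofReal_sum_of_nonneg hw0, hw1, ENNReal.ofReal_one]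
    · intro i
      rw [hR]
      have := congrFun h (Sum.inl i)
      simpa using this
    · intro q hq
      rw [hR]
      have := congrFun h (Sum.inr ⟨q, hq⟩)
      simpa using this
end

section
/- A vector (p_1, p_2, p_{12}) ∈ ℝ³ lies in the convex hull of the four points (0,0,0), (1,0,0), (0,1,0), (1,1,1) if and only if it satisfies the four inequalities: 0 ≤ p_{12}, p_{12} ≤ p_1, p_{12} ≤ p_2, and p_1 + p_2 − p_{12} ≤ 1. -/
/-- A vector `(p₁, p₂, p₁₂) ∈ ℝ³` lies in the convex hull of
`(0,0,0), (1,0,0), (0,1,0), (1,1,1)` iff `0 ≤ p₁₂`, `p₁₂ ≤ p₁`, `p₁₂ ≤ p₂` and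
`p₁ + p₂ − p₁₂ ≤ 1`. -/
theorem mem_correlation_polytope_iff_inequalities (p1 p2 p12 : ℝ) :
    ![p1, p2, p12] ∈ convexHull ℝ
      ({![0, 0, 0], ![1, 0, 0], ![0, 1, 0], ![1, 1, 1]} : Set (Fin 3 → ℝ)) ↔
    (0 ≤ p12 ∧ p12 ≤ p1 ∧ p12 ≤ p2 ∧ p1 + p2 - p12 ≤ 1) := by
  constructor
  · intro h
    have hc : Convex ℝ {v : Fin 3 → ℝ | 0 ≤ v 2 ∧ v 2 ≤ v 0 ∧ v 2 ≤ v 1 ∧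
        v 0 + v 1 - v 2 ≤ 1} := by
      rintro x ⟨h1, h2, h3, h4⟩ y ⟨k1, k2, k3, k4⟩ a b ha hb hab
      simp only [Set.mem_ofPred_eq, Pi.add_apply, Pi.smul_apply, smul_eq_mul]
      have m1 := mul_le_mul_of_nonneg_left h1 ha
      have m2 := mul_le_mul_of_nonneg_left h2 ha
      have m3 := mul_le_mul_of_nonneg_left h3 ha
      have m4 := mul_le_mul_of_nonneg_left h4 ha
      have n1 := mul_le_mul_of_nonneg_left k1 hb
      have n2 := mul_le_mul_of_nonneg_left k2 hb
      have n3 := mul_le_mul_of_nonneg_left k3 hb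
      have n4 := mul_le_mul_of_nonneg_left k4 hb
      refine ⟨?_, ?_, ?_, ?_⟩ <;> linarith
    have hm := convexHull_min (t := {v : Fin 3 → ℝ | 0 ≤ v 2 ∧ v 2 ≤ v 0 ∧ v 2 ≤ v 1 ∧
        v 0 + v 1 - v 2 ≤ 1}) (by
      rintro v (rfl | rfl | rfl | rfl) <;> simp) hc h
    simpa using hm
  · rintro ⟨h1, h2, h3, h4⟩
    have key := (convex_convexHull ℝ
      ({![0, 0, 0], ![1, 0, 0], ![0, 1, 0], ![1, 1, 1]} : Set (Fin 3 → ℝ))).sum_mem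
      (t := Finset.univ) (w := ![1 - p1 - p2 + p12, p1 - p12, p2 - p12, p12])
      (z := ![![0, 0, 0], ![1, 0, 0], ![0, 1, 0], ![1, 1, 1]])
      (by
        intro i _
        fin_cases i <;> simp <;> linarith)
      (by
        simp [Fin.sum_univ_four]
        ring)
      (by
        intro i _
        apply subset_convexHull
        fin_cases i <;> simp)
    convert key using 1
    ext i
    fin_cases i <;> simp [Fin.sum_univ_four]
end

section
/- Real numbers μ(A_1), μ(A_2), μ(A_1 and A_2) admit a classical representation — i.e., there exist a probability measure space (Ω, σ(Ω), P) and measurable events E_{A_1}, E_{A_2} with P(E_{A_1}) = μ(A_1), P(E_{A_2}) = μ(A_2), and P(E_{A_1} ∩ E_{A_2}) = μ(A_1 and A_2) — if and only if the four inequalities hold: 0 ≤ μ(A_1 and A_2), μ(A_1 and A_2) ≤ μ(A_1), μ(A_1 and A_2) ≤ μ(A_2), and μ(A_1) + μ(A_2) − μ(A_1 and A_2) ≤ 1. -/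
open MeasureTheory

/-- Membership weights `μ₁, μ₂, μ₁₂` admit a classical (probability measure)
representation iff `0 ≤ μ₁₂`, `μ₁₂ ≤ μ₁`, `μ₁₂ ≤ μ₂` and `μ₁ + μ₂ − μ₁₂ ≤ 1`. -/
theorem classical_membership_weights_iff_inequalities (μ1 μ2 μ12 : ℝ) :
    (∃ (Ω : Type) (_ : MeasurableSpace Ω) (P : Measure Ω),
        IsProbabilityMeasure P ∧
        ∃ E1 E2 : Set Ω, MeasurableSet E1 ∧ MeasurableSet E2 ∧
          (P E1).toReal = μ1 ∧ (P E2).toReal = μ2 ∧ (P (E1 ∩ E2)).toReal = μ12) ↔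
    (0 ≤ μ12 ∧ μ12 ≤ μ1 ∧ μ12 ≤ μ2 ∧ μ1 + μ2 - μ12 ≤ 1) := by
  constructor
  · rintro ⟨Ω, _, P, hP, E1, E2, h1, h2, rfl, rfl, rfl⟩
    have hu := measureReal_union_add_inter (μ := P) (s := E1) h2
    have hle : P.real (E1 ∪ E2) ≤ 1 := measureReal_le_one
    have hl : P.real (E1 ∩ E2) ≤ P.real E1 := measureReal_mono Set.inter_subset_left
    have hr : P.real (E1 ∩ E2) ≤ P.real E2 := measureReal_mono Set.inter_subset_right
    simp only [Measure.real] at hu hle hl hr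
    exact ⟨ENNReal.toReal_nonneg, hl, hr, by linarith⟩
  · rintro ⟨h0, h1, h2, h3⟩
    have a1 : 0 ≤ μ1 - μ12 := by linarith
    have a2 : 0 ≤ μ2 - μ12 := by linarith
    have a3 : 0 ≤ 1 - μ1 - μ2 + μ12 := by linarith
    refine ⟨Fin 4, ⊤, ENNReal.ofReal μ12 • @Measure.dirac _ ⊤ 0
      + ENNReal.ofReal (μ1 - μ12) • @Measure.dirac _ ⊤ 1
      + ENNReal.ofReal (μ2 - μ12) • @Measure.dirac _ ⊤ 2
      + ENNReal.ofReal (1 - μ1 - μ2 + μ12) • @Measure.dirac _ ⊤ 3, ⟨?_⟩,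
      {0, 1}, {0, 2}, trivial, trivial, ?_, ?_, ?_⟩
    · simp
      rw [← ENNReal.ofReal_add (by positivity) (by positivity),
        ← ENNReal.ofReal_add (by positivity) (by positivity),
        ← ENNReal.ofReal_add (by positivity) (by positivity), ← ENNReal.ofReal_one]
      congr 1
      ring
    · simp [Set.indicator]
      rw [← ENNReal.ofReal_add h0 a1, ENNReal.toReal_ofReal (by linarith)]
      ring
    · simp [Set.indicator]
      rw [← ENNReal.ofReal_add h0 a2, ENNReal.toReal_ofReal (by linarith)]
      ring
    · simp [Set.indicator, h0]
end

section
/- Real numbers μ(A_1), μ(A_2), μ(A_1 and A_2) admit a classical representation by a probability measure space if and only if the vector (μ(A_1), μ(A_2), μ(A_1 and A_2)) ∈ ℝ³ lies in the convex hull of the four points (0,0,0), (1,0,0), (0,1,0), (1,1,1). -/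
open MeasureTheory

lemma polytope_ineqs {a b c : ℝ}
    (h : ![a, b, c] ∈ convexHull ℝ
      ({![0, 0, 0], ![1, 0, 0], ![0, 1, 0], ![1, 1, 1]} : Set (Fin 3 → ℝ))) :
    0 ≤ c ∧ c ≤ a ∧ c ≤ b ∧ a + b - c ≤ 1 := by
  have hsub : convexHull ℝ
      ({![0, 0, 0], ![1, 0, 0], ![0, 1, 0], ![1, 1, 1]} : Set (Fin 3 → ℝ)) ⊆
      {v | 0 ≤ v 2 ∧ v 2 ≤ v 0 ∧ v 2 ≤ v 1 ∧ v 0 + v 1 - v 2 ≤ 1} := by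
    apply convexHull_min
    · rintro v (rfl | rfl | rfl | rfl) <;> simp
    · rintro x ⟨h1, h2, h3, h4⟩ y ⟨k1, k2, k3, k4⟩ s t hs ht hst
      simp only [Set.mem_ofPred_eq, Pi.add_apply, Pi.smul_apply, smul_eq_mul]
      refine ⟨by positivity, by gcongr, by gcongr, ?_⟩
      have e1 := mul_le_mul_of_nonneg_left h4 hs
      have e2 := mul_le_mul_of_nonneg_left k4 ht
      nlinarith
  simpa using hsub h

lemma mem_polytope {a b c : ℝ} (h0 : 0 ≤ c) (h1 : c ≤ a) (h2 : c ≤ b) (h3 : a + b - c ≤ 1) :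
    ![a, b, c] ∈ convexHull ℝ
      ({![0, 0, 0], ![1, 0, 0], ![0, 1, 0], ![1, 1, 1]} : Set (Fin 3 → ℝ)) := by
  have key := (convex_convexHull ℝ
      ({![0, 0, 0], ![1, 0, 0], ![0, 1, 0], ![1, 1, 1]} : Set (Fin 3 → ℝ))).sum_mem
      (t := (Finset.univ : Finset (Fin 4)))
      (w := ![1 - a - b + c, a - c, b - c, c])
      (z := ![![0, 0, 0], ![1, 0, 0], ![0, 1, 0], ![1, 1, 1]])
      (by intro i _; fin_cases i <;> simp <;> linarith)
      (by simp [Fin.sum_univ_four]; ring)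
      (by intro i _; apply subset_convexHull; fin_cases i <;> simp)
  convert key using 1
  ext i
  fin_cases i <;> simp [Fin.sum_univ_four]

lemma exists_measure {a b c : ℝ} (h0 : 0 ≤ c) (h1 : c ≤ a) (h2 : c ≤ b) (h3 : a + b - c ≤ 1) :
    ∃ (Ω : Type) (_ : MeasurableSpace Ω) (P : Measure Ω),
        IsProbabilityMeasure P ∧
        ∃ E1 E2 : Set Ω, MeasurableSet E1 ∧ MeasurableSet E2 ∧
          (P E1).toReal = a ∧ (P E2).toReal = b ∧ (P (E1 ∩ E2)).toReal = c := by
  have p0 : 0 ≤ 1 - a - b + c := by linarith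
  have p1 : 0 ≤ a - c := by linarith
  have p2 : 0 ≤ b - c := by linarith
  refine ⟨Fin 4, ⊤, ENNReal.ofReal (1 - a - b + c) • @Measure.dirac _ ⊤ 0
    + ENNReal.ofReal (a - c) • @Measure.dirac _ ⊤ 1
    + ENNReal.ofReal (b - c) • @Measure.dirac _ ⊤ 2
    + ENNReal.ofReal c • @Measure.dirac _ ⊤ 3, ⟨?_⟩, {1, 3}, {2, 3}, trivial, trivial, ?_, ?_, ?_⟩
  · simp
    rw [← ENNReal.ofReal_add p0 p1, ← ENNReal.ofReal_add (by linarith) p2,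
      ← ENNReal.ofReal_add (by linarith) h0]
    ring_nf
    simp
  · simp [Set.indicator]
    rw [← ENNReal.ofReal_add p1 h0, ENNReal.toReal_ofReal (by linarith)]
    ring
  · simp [Set.indicator]
    rw [← ENNReal.ofReal_add p2 h0, ENNReal.toReal_ofReal (by linarith)]
    ring
  · simp [Set.indicator, h0]

/-- Membership weights `μ₁, μ₂, μ₁₂` admit a classical (probability measure)
representation iff the vector `(μ₁, μ₂, μ₁₂) ∈ ℝ³` lies in the convex hull of
`(0,0,0), (1,0,0), (0,1,0), (1,1,1)`. -/
theorem classical_membership_weights_iff_mem_polytope (μ1 μ2 μ12 : ℝ) :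
    (∃ (Ω : Type) (_ : MeasurableSpace Ω) (P : Measure Ω),
        IsProbabilityMeasure P ∧
        ∃ E1 E2 : Set Ω, MeasurableSet E1 ∧ MeasurableSet E2 ∧
          (P E1).toReal = μ1 ∧ (P E2).toReal = μ2 ∧ (P (E1 ∩ E2)).toReal = μ12) ↔
    ![μ1, μ2, μ12] ∈ convexHull ℝ
      ({![0, 0, 0], ![1, 0, 0], ![0, 1, 0], ![1, 1, 1]} : Set (Fin 3 → ℝ)) := by
  constructor
  · rintro ⟨Ω, _, P, hP, E1, E2, m1, m2, rfl, rfl, rfl⟩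
    have hu : P.real (E1 ∪ E2) + P.real (E1 ∩ E2) = P.real E1 + P.real E2 :=
      measureReal_union_add_inter m2
    have hle : P.real (E1 ∪ E2) ≤ 1 := measureReal_le_one
    have i1 : P.real (E1 ∩ E2) ≤ P.real E1 := measureReal_mono Set.inter_subset_left
    have i2 : P.real (E1 ∩ E2) ≤ P.real E2 := measureReal_mono Set.inter_subset_right
    exact mem_polytope ENNReal.toReal_nonneg i1 i2
      (by change P.real E1 + P.real E2 - P.real (E1 ∩ E2) ≤ 1; linarith)
  · intro h
    obtain ⟨h0, h1, h2, h3⟩ := polytope_ineqs h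
    exact exists_measure h0 h1 h2 h3
end
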